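/- arXiv:1811.06205 — 2 statements merged into one kernel-verified Lean document; each statement's English description precedes it below -/
import Mathlib

section
/- Let G be a finite pseudoreflection subgroup of GL(n,ℂ), d = |G|, let p₁,…,p_d be a basis of ℂ[z] as a module over ℂ[z]^G, and let Λ be the d×d matrix with (i,j)-entry ρᵢ·p_j. Let m be the number of pseudoreflections contained in G. Then det Λ is a homogeneous polynomial of degree d·m/2. -/
open MvPolynomial

noncomputable section

/-- The natural action of an invertible matrix on `ℂⁿ` by matrix-vector multiplication. -/
def gAct {n : ℕ} (σ : GL (Fin n) ℂ) (z : Fin n → ℂ) : Fin n → ℂ :=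
  Matrix.mulVec (σ : Matrix (Fin n) (Fin n) ℂ) z

/-- A pseudoreflection: an element of finite order in `GL(n,ℂ)` with `rank (1 - ρ) = 1`. -/
def IsPseudoreflection {n : ℕ} (ρ : GL (Fin n) ℂ) : Prop :=
  IsOfFinOrder ρ ∧ Matrix.rank ((1 : Matrix (Fin n) (Fin n) ℂ) - (ρ : Matrix (Fin n) (Fin n) ℂ)) = 1

/-- A subgroup of `GL(n,ℂ)` is a pseudoreflection group if it is generated by the
pseudoreflections it contains. -/
def IsPseudoreflectionGroup {n : ℕ} (G : Subgroup (GL (Fin n) ℂ)) : Prop :=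
  Subgroup.closure {ρ : GL (Fin n) ℂ | ρ ∈ G ∧ IsPseudoreflection ρ} = G

/-- The action of `σ ∈ GL(n,ℂ)` on polynomials: `(σ·p)(z) = p(σ⁻¹z)`. -/
def polyAct {n : ℕ} (σ : GL (Fin n) ℂ) (p : MvPolynomial (Fin n) ℂ) : MvPolynomial (Fin n) ℂ :=
  MvPolynomial.aeval
    (fun i => ∑ j, MvPolynomial.C (((σ⁻¹ : GL (Fin n) ℂ) : Matrix (Fin n) (Fin n) ℂ) i j)
      * MvPolynomial.X j) p

/-- The polynomial map `θ : ℂⁿ → ℂⁿ` associated to a tuple of polynomials. -/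
def polyMap {n : ℕ} (θ : Fin n → MvPolynomial (Fin n) ℂ) (z : Fin n → ℂ) : Fin n → ℂ :=
  fun i => MvPolynomial.eval z (θ i)

theorem gAct_one {n : ℕ} (z : Fin n → ℂ) : gAct 1 z = z := by simp [gAct]

theorem gAct_mul {n : ℕ} (σ τ : GL (Fin n) ℂ) (z : Fin n → ℂ) :
    gAct (σ * τ) z = gAct σ (gAct τ z) := by simp [gAct]

theorem gAct_add {n : ℕ} (σ : GL (Fin n) ℂ) (z w : Fin n → ℂ) :
    gAct σ (z + w) = gAct σ z + gAct σ w := Matrix.mulVec_add _ _ _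

theorem gAct_smul {n : ℕ} (σ : GL (Fin n) ℂ) (c : ℂ) (z : Fin n → ℂ) :
    gAct σ (c • z) = c • gAct σ z := Matrix.mulVec_smul _ _ _

theorem gAct_inv_gAct {n : ℕ} (σ : GL (Fin n) ℂ) (z : Fin n → ℂ) :
    gAct σ⁻¹ (gAct σ z) = z := by rw [← gAct_mul, inv_mul_cancel, gAct_one]

theorem gAct_injective {n : ℕ} (σ : GL (Fin n) ℂ) : Function.Injective (gAct σ) :=
  Function.LeftInverse.injective (gAct_inv_gAct σ)

theorem gAct_zero {n : ℕ} (σ : GL (Fin n) ℂ) : gAct σ 0 = 0 := Matrix.mulVec_zero _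

/-- Restriction of a polynomial to the parametrized line `t ↦ a + t b`. -/
def lineRestr {n : ℕ} (a b : Fin n → ℂ) : MvPolynomial (Fin n) ℂ →ₐ[ℂ] Polynomial ℂ :=
  MvPolynomial.aeval fun i => Polynomial.C (a i) + Polynomial.C (b i) * Polynomial.X

/-- Restriction of a polynomial to the parametrized plane `(t, x) ↦ a + t b + x c`,
where `x` is the outer variable. -/
def planeRestr {n : ℕ} (a b c : Fin n → ℂ) :
    MvPolynomial (Fin n) ℂ →ₐ[ℂ] Polynomial (Polynomial ℂ) :=
  MvPolynomial.aeval fun i =>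
    Polynomial.C (Polynomial.C (a i) + Polynomial.C (b i) * Polynomial.X) +
      Polynomial.C (Polynomial.C (c i)) * Polynomial.X

theorem lineRestr_C {n : ℕ} (a b : Fin n → ℂ) (c : ℂ) :
    lineRestr a b (C c) = Polynomial.C c :=
  MvPolynomial.aeval_C _ _

theorem lineRestr_X {n : ℕ} (a b : Fin n → ℂ) (i : Fin n) :
    lineRestr a b (X i) = Polynomial.C (a i) + Polynomial.C (b i) * Polynomial.X :=
  MvPolynomial.aeval_X _ _

theorem planeRestr_C {n : ℕ} (a b c : Fin n → ℂ) (x : ℂ) :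
    planeRestr a b c (C x) = Polynomial.C (Polynomial.C x) :=
  MvPolynomial.aeval_C _ _

theorem planeRestr_X {n : ℕ} (a b c : Fin n → ℂ) (i : Fin n) :
    planeRestr a b c (X i) =
      Polynomial.C (Polynomial.C (a i) + Polynomial.C (b i) * Polynomial.X) +
        Polynomial.C (Polynomial.C (c i)) * Polynomial.X :=
  MvPolynomial.aeval_X _ _

theorem polyAct_C {n : ℕ} (σ : GL (Fin n) ℂ) (c : ℂ) : polyAct σ (C c) = C c :=
  MvPolynomial.aeval_C _ _

theorem polyAct_X {n : ℕ} (σ : GL (Fin n) ℂ) (i : Fin n) :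
    polyAct σ (X i) =
      ∑ j, C (((σ⁻¹ : GL (Fin n) ℂ) : Matrix (Fin n) (Fin n) ℂ) i j) * X j :=
  MvPolynomial.aeval_X _ _

theorem polyAct_add {n : ℕ} (σ : GL (Fin n) ℂ) (p q : MvPolynomial (Fin n) ℂ) :
    polyAct σ (p + q) = polyAct σ p + polyAct σ q :=
  map_add (aeval _) _ _

theorem polyAct_mul {n : ℕ} (σ : GL (Fin n) ℂ) (p q : MvPolynomial (Fin n) ℂ) :
    polyAct σ (p * q) = polyAct σ p * polyAct σ q :=
  map_mul (aeval _) _ _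

theorem eval_lineRestr {n : ℕ} (a b : Fin n → ℂ) (t : ℂ) (p : MvPolynomial (Fin n) ℂ) :
    (lineRestr a b p).eval t = MvPolynomial.eval (a + t • b) p := by
  induction p using MvPolynomial.induction_on with
  | C c => rw [lineRestr_C, Polynomial.eval_C, MvPolynomial.eval_C]
  | add p q hp hq => rw [map_add, map_add, Polynomial.eval_add, hp, hq]
  | mul_X p i hp =>
    rw [map_mul, map_mul, Polynomial.eval_mul, hp, lineRestr_X, MvPolynomial.eval_X]
    simp [-Polynomial.X_mul_C, mul_comm t]

theorem lineRestr_polyAct {n : ℕ} (a b : Fin n → ℂ) (σ : GL (Fin n) ℂ)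
    (p : MvPolynomial (Fin n) ℂ) :
    lineRestr a b (polyAct σ p) = lineRestr (gAct σ⁻¹ a) (gAct σ⁻¹ b) p := by
  induction p using MvPolynomial.induction_on with
  | C c => rw [polyAct_C, lineRestr_C, lineRestr_C]
  | add p q hp hq => rw [polyAct_add, map_add, map_add, hp, hq]
  | mul_X p i hp =>
    rw [polyAct_mul, map_mul (lineRestr a b), hp,
      map_mul (lineRestr (gAct σ⁻¹ a) (gAct σ⁻¹ b))]
    refine congrArg _ ?_
    rw [polyAct_X, map_sum, lineRestr_X, gAct, gAct]
    generalize ((σ⁻¹ : GL (Fin n) ℂ) : Matrix (Fin n) (Fin n) ℂ) = A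
    simp only [map_mul, lineRestr_C, lineRestr_X, Matrix.mulVec, dotProduct, map_sum,
      Finset.sum_mul, mul_add, Finset.sum_add_distrib, mul_assoc]

theorem lineRestr_smul {n : ℕ} (a b : Fin n → ℂ) (c : ℂ) (p : MvPolynomial (Fin n) ℂ) :
    lineRestr a (c • b) p = (lineRestr a b p).comp (Polynomial.C c * Polynomial.X) := by
  apply Polynomial.funext
  intro t
  rw [Polynomial.eval_comp, eval_lineRestr, eval_lineRestr, smul_smul, Polynomial.eval_mul,
    Polynomial.eval_C, Polynomial.eval_X, mul_comm]

theorem lineRestr_comp_X_add_C {n : ℕ} (a b : Fin n → ℂ) (t : ℂ) (p : MvPolynomial (Fin n) ℂ) :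
    (lineRestr a b p).comp (Polynomial.X + Polynomial.C t) = lineRestr (a + t • b) b p := by
  apply Polynomial.funext
  intro s
  simp only [eval_lineRestr, Polynomial.eval_comp, Polynomial.eval_add, Polynomial.eval_X,
    Polynomial.eval_C]
  congr 2
  module

theorem eval_planeRestr {n : ℕ} (a b c : Fin n → ℂ) (x : ℂ) (p : MvPolynomial (Fin n) ℂ) :
    (planeRestr a b c p).eval (Polynomial.C x * Polynomial.X) = lineRestr a (b + x • c) p := by
  induction p using MvPolynomial.induction_on with
  | C c => rw [planeRestr_C, lineRestr_C, Polynomial.eval_C]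
  | add p q hp hq => rw [map_add, map_add, Polynomial.eval_add, hp, hq]
  | mul_X p i hp =>
    rw [map_mul, map_mul, Polynomial.eval_mul, hp, planeRestr_X, lineRestr_X]
    congr 1
    simp only [Polynomial.eval_add, Polynomial.eval_C, Polynomial.eval_mul, Polynomial.eval_X,
      Pi.add_apply, Pi.smul_apply, smul_eq_mul, map_add, map_mul]
    ring

theorem map_planeRestr {n : ℕ} (a b c : Fin n → ℂ) (p : MvPolynomial (Fin n) ℂ) :
    (planeRestr a b c p).map (Polynomial.evalRingHom 0) = lineRestr a c p := by
  induction p using MvPolynomial.induction_on with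
  | C c => rw [planeRestr_C, lineRestr_C]; simp
  | add p q hp hq => rw [map_add, map_add, Polynomial.map_add, hp, hq]
  | mul_X p i hp =>
    rw [map_mul, map_mul, Polynomial.map_mul, hp, planeRestr_X, lineRestr_X]
    simp

/-- The part of a polynomial in the exponents congruent to `a` modulo `m`, divided by `X ^ a` and
evaluated at `y`. -/
def residuePart {R : Type*} [CommRing R] (m a : ℕ) (y : R) (P : Polynomial R) : R :=
  P.sum fun k c => if k % m = a then c * y ^ (k - a) else 0

theorem eval_mul_eq_sum_residuePart {R : Type*} [CommRing R] {m : ℕ} (hm : 0 < m) (x y : R)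
    (hx : x ^ m = 1) (P : Polynomial R) :
    P.eval (x * y) = ∑ a : Fin m, (x ^ (a : ℕ) * y ^ (a : ℕ)) * residuePart m a y P := by
  simp only [residuePart, Polynomial.sum_def, Polynomial.eval_eq_sum, Finset.mul_sum]
  rw [Finset.sum_comm]
  refine Finset.sum_congr rfl fun k _ => ?_
  rw [Finset.sum_eq_single (⟨k % m, Nat.mod_lt k hm⟩ : Fin m)]
  · have h1 : x ^ k = x ^ (k % m) := by
      conv_lhs => rw [← Nat.mod_add_div k m, pow_add, pow_mul, hx, one_pow, mul_one]
    have h2 : y ^ k = y ^ (k % m) * y ^ (k - k % m) := by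
      rw [← pow_add, Nat.add_sub_cancel' (Nat.mod_le k m)]
    simp only [if_true]
    rw [mul_pow, h1, h2]
    ring
  · intro b _ hb
    rw [if_neg, mul_zero]
    exact fun h => hb (Fin.ext h.symm)
  · simp

theorem eval_zero_residuePart (m a : ℕ) (ha : a < m) (P : Polynomial (Polynomial ℂ)) :
    (residuePart m a Polynomial.X P).eval 0 = (P.coeff a).eval 0 := by
  rw [residuePart, Polynomial.sum_def, Polynomial.eval_finsetSum,
    Finset.sum_eq_single a]
  · simp [Nat.mod_eq_of_lt ha]
  · intro k _ hk
    split_ifs with h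
    · have : k - a ≠ 0 := by
        have := Nat.mod_le k m
        omega
      simp [this]
    · simp
  · intro h
    simp [Polynomial.notMem_support_iff.mp h]

theorem exists_eval_eq_one_and_eval_eq_zero {n : ℕ} {ι : Type*} [Finite ι] (w : ι → Fin n → ℂ)
    (hw : Function.Injective w) (s : ι) :
    ∃ q : MvPolynomial (Fin n) ℂ, eval (w s) q = 1 ∧ ∀ s' ≠ s, eval (w s') q = 0 := by
  classical
  have := Fintype.ofFinite ι
  have key : ∀ s', ∃ q : MvPolynomial (Fin n) ℂ,
      eval (w s) q = 1 ∧ (s' ≠ s → eval (w s') q = 0) := by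
    intro s'
    by_cases h : s' = s
    · exact ⟨1, by simp, fun h' => absurd h h'⟩
    · obtain ⟨i, hi⟩ : ∃ i, w s' i ≠ w s i := by
        by_contra! hcon
        exact h (hw (funext hcon))
      refine ⟨C ((w s i - w s' i)⁻¹) * (X i - C (w s' i)), ?_, fun _ => by simp⟩
      have : w s i - w s' i ≠ 0 := sub_ne_zero.mpr hi.symm
      simp [this]
  choose q hq1 hq0 using key
  refine ⟨∏ s', q s', by simp [map_prod, hq1], fun s' hs' => ?_⟩
  rw [map_prod]
  exact Finset.prod_eq_zero (Finset.mem_univ s') (hq0 s' hs')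

theorem coeff_lineRestr_pow_of_eval_eq_zero {n : ℕ} (a b : Fin n → ℂ) (q : MvPolynomial (Fin n) ℂ)
    (hq : eval a q = 0) {m k : ℕ} (hk : k < m) (r : MvPolynomial (Fin n) ℂ) :
    (lineRestr a b (q ^ m * r)).coeff k = 0 := by
  have h : Polynomial.X ∣ lineRestr a b q := by
    rw [Polynomial.X_dvd_iff, Polynomial.coeff_zero_eq_eval_zero, eval_lineRestr]
    simpa using hq
  have h2 : Polynomial.X ^ m ∣ lineRestr a b (q ^ m * r) := by
    rw [map_mul, map_pow]
    exact Dvd.dvd.mul_right (pow_dvd_pow_of_dvd h m) _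
  exact Polynomial.X_pow_dvd_iff.mp h2 k hk

/-- A nonzero linear combination of jet coefficients along lines through distinct points does not
vanish on all polynomials. -/
theorem eq_zero_of_forall_sum_coeff_lineRestr {n m : ℕ} {ι : Type*} [Fintype ι]
    (w b : ι → Fin n → ℂ) (hw : Function.Injective w) (hb : 1 < m → ∀ s, b s ≠ 0)
    (c : Fin m × ι → ℂ)
    (h : ∀ q : MvPolynomial (Fin n) ℂ,
      ∑ x : Fin m × ι, c x * (lineRestr (w x.2) (b x.2) q).coeff x.1 = 0) : c = 0 := by
  classical
  by_contra hc
  obtain ⟨⟨a₁, s⟩, hx⟩ := Function.ne_iff.mp hc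
  obtain ⟨a, ha, hmax⟩ := (Finset.univ.filter fun a => c (a, s) ≠ 0).exists_maximal
    ⟨a₁, by simpa using hx⟩
  simp only [Finset.mem_filter, Finset.mem_univ, true_and] at ha hmax
  obtain ⟨q, hq1, hq0⟩ := exists_eval_eq_one_and_eval_eq_zero w hw s
  obtain ⟨l, hl⟩ : ∃ l : MvPolynomial (Fin n) ℂ,
      lineRestr (w s) (b s) (l ^ (a : ℕ)) = Polynomial.X ^ (a : ℕ) := by
    by_cases ha0 : (a : ℕ) = 0
    · exact ⟨1, by simp [ha0]⟩
    · obtain ⟨i, hi⟩ := Function.ne_iff.mp (hb (by omega) s)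
      refine ⟨C ((b s i)⁻¹) * (X i - C (w s i)), ?_⟩
      rw [map_pow]
      congr 1
      simp only [lineRestr, map_mul, map_sub, aeval_X, aeval_C, ← Polynomial.C_eq_algebraMap]
      rw [add_sub_cancel_left, ← mul_assoc, ← Polynomial.C_mul, inv_mul_cancel₀ hi]
      simp
  have h1 := h (q ^ m * l ^ (a : ℕ))
  rw [Finset.sum_eq_single (a, s)] at h1
  · rw [map_mul, hl, Polynomial.coeff_mul_X_pow', if_pos le_rfl, Nat.sub_self,
      Polynomial.coeff_zero_eq_eval_zero, eval_lineRestr] at h1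
    simp [hq1] at h1
    exact ha h1
  · rintro ⟨a', s'⟩ _ hne
    by_cases hs : s' = s
    · subst hs
      have haa : a' ≠ a := fun h => hne (by rw [h])
      rcases lt_or_gt_of_ne haa with hlt | hgt
      · rw [map_mul, hl, Polynomial.coeff_mul_X_pow', if_neg (by simpa using hlt), mul_zero]
      · by_cases hc0 : c (a', s') = 0
        · simp [hc0]
        · exact absurd (hmax hc0 hgt.le) (not_le.mpr hgt)
    · rw [coeff_lineRestr_pow_of_eval_eq_zero _ _ _ (hq0 s' hs) a'.isLt, mul_zero]
  · simp

theorem bijective_out_mul_of_equiv {Γ : Type*} [Group Γ] (S : Subgroup Γ) {ι : Type*}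
    (η : ι ≃ S) : Function.Bijective fun x : ι × (Γ ⧸ S) => (Quotient.out x.2 : Γ) * (η x.1 : Γ) := by
  constructor
  · rintro ⟨k, s⟩ ⟨k', s'⟩ h
    simp only at h
    have hs : s = s' := by
      have h1 : ((Quotient.out s * (η k : Γ) : Γ) : Γ ⧸ S) = s := by
        rw [QuotientGroup.mk_mul_of_mem _ (η k).2, QuotientGroup.out_eq']
      have h2 : ((Quotient.out s' * (η k' : Γ) : Γ) : Γ ⧸ S) = s' := by
        rw [QuotientGroup.mk_mul_of_mem _ (η k').2, QuotientGroup.out_eq']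
      rw [← h1, h, h2]
    subst hs
    have := η.injective (Subtype.ext (mul_left_cancel h))
    rw [this]
  · intro g
    have h : (Quotient.out (g : Γ ⧸ S))⁻¹ * g ∈ S := by
      rw [← QuotientGroup.eq, QuotientGroup.out_eq']
    exact ⟨(η.symm ⟨_, h⟩, (g : Γ ⧸ S)), by simp⟩

theorem exists_pow_ne_one_of_injective {ι : Type*} [Finite ι] (χ : ι → ℂ)
    (hχ : Function.Injective χ) {k : ℕ} (hk : 0 < k) (hkm : k < Nat.card ι) :
    ∃ i, χ i ^ k ≠ 1 := by
  classical
  have := Fintype.ofFinite ι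
  by_contra! hcon
  have h1 : (Finset.univ.image χ) ⊆ (Polynomial.nthRoots k (1 : ℂ)).toFinset := by
    intro x hx
    obtain ⟨i, -, rfl⟩ := Finset.mem_image.mp hx
    rw [Multiset.mem_toFinset, Polynomial.mem_nthRoots hk]
    exact hcon i
  have h2 := (Finset.card_le_card h1).trans
    ((Multiset.toFinset_card_le _).trans (Polynomial.card_nthRoots k (1 : ℂ)))
  rw [Finset.card_image_of_injective _ hχ, Finset.card_univ, ← Nat.card_eq_fintype_card] at h2
  omega

/-- A polynomial `R` with `R(χ x) = R(x)` for `m` distinct values of `χ` is constant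
modulo `x ^ m`. -/
theorem coeff_eq_zero_of_forall_comp_eq {ι : Type*} [Finite ι] (χ : ι → ℂ)
    (hχ : Function.Injective χ) (R : Polynomial ℂ)
    (hR : ∀ i, R.comp (Polynomial.C (χ i) * Polynomial.X) = R) {k : ℕ} (hk : 0 < k)
    (hkm : k < Nat.card ι) : R.coeff k = 0 := by
  obtain ⟨i, hi⟩ := exists_pow_ne_one_of_injective χ hχ hk hkm
  have h := congrArg (fun P => Polynomial.coeff P k) (hR i)
  simp only [Polynomial.comp_C_mul_X_coeff] at h
  by_contra hne
  exact hi (mul_left_cancel₀ hne (by rw [h, mul_one]))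

theorem coeff_mul_of_coeff_eq_zero {R P : Polynomial ℂ} {m : ℕ}
    (hR : ∀ k, 0 < k → k < m → R.coeff k = 0) {a : ℕ} (ha : a < m) :
    (R * P).coeff a = R.coeff 0 * P.coeff a := by
  rw [Polynomial.coeff_mul, Finset.sum_eq_single (0, a)]
  · rintro ⟨i, j⟩ hij hne
    rw [Finset.HasAntidiagonal.mem_antidiagonal] at hij
    simp only at hij
    rcases Nat.eq_zero_or_pos i with rfl | hi
    · exact absurd (by simpa using hij) hne
    · rw [hR i hi (by omega), zero_mul]
  · simp

theorem det_blockDiagonal_vandermonde_X {m : ℕ} {ι : Type*} [Fintype ι] [DecidableEq ι]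
    (χ : Fin m → ℂ) :
    (Matrix.blockDiagonal fun _ : ι => Matrix.of fun k a : Fin m =>
        (Polynomial.C (χ k) ^ (a : ℕ) * Polynomial.X ^ (a : ℕ) : Polynomial ℂ)).det =
      Polynomial.X ^ ((∑ a ∈ Finset.range m, a) * Fintype.card ι) *
        Polynomial.C ((Matrix.vandermonde χ).det ^ Fintype.card ι) := by
  have h : (Matrix.of fun k a : Fin m =>
      (Polynomial.C (χ k) ^ (a : ℕ) * Polynomial.X ^ (a : ℕ) : Polynomial ℂ)) =
      Polynomial.C.mapMatrix (Matrix.vandermonde χ) *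
        Matrix.diagonal fun a : Fin m => Polynomial.X ^ (a : ℕ) := by
    ext1 k a
    simp [Matrix.vandermonde_apply]
  rw [Matrix.det_blockDiagonal, Finset.prod_const, Finset.card_univ, h, Matrix.det_mul,
    Matrix.det_diagonal, ← RingHom.map_det, Finset.prod_pow_eq_pow_sum,
    Fin.sum_univ_eq_sum_range (fun a => a), mul_pow, ← pow_mul, map_pow, mul_comm]

/-- Along a line `t ↦ z + t (h + ρ)` through a point `z` whose stabilizer `S` fixes `h` and acts on
`ρ` by an injective character, the determinant vanishes at `t = 0` to order
`d (|S| - 1) / 2`. -/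
theorem exists_lineRestr_det_eq {n : ℕ} (G : Subgroup (GL (Fin n) ℂ)) [Finite G] {d : ℕ}
    (e : Fin d ≃ G) (p : Fin d → MvPolynomial (Fin n) ℂ)
    (hspan : ∀ q : MvPolynomial (Fin n) ℂ, ∃ r : Fin d → MvPolynomial (Fin n) ℂ,
      (∀ i, ∀ σ ∈ G, polyAct σ (r i) = r i) ∧ q = ∑ i, r i * p i)
    (z h ρ : Fin n → ℂ) (S : Subgroup G)
    (hS : ∀ g : G, g ∈ S ↔ gAct (g : GL (Fin n) ℂ) z = z)
    (χ : S → ℂ) (hχ : Function.Injective χ) (hχm : ∀ g, χ g ^ Nat.card S = 1)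
    (hh : ∀ g : S, gAct ((g : G) : GL (Fin n) ℂ) h = h)
    (hρ : ∀ g : S, gAct ((g : G) : GL (Fin n) ℂ) ρ = χ g • ρ)
    (hρ0 : 1 < Nat.card S → ρ ≠ 0) :
    ∃ (N : ℕ) (Q : Polynomial ℂ), 2 * N = d * (Nat.card S - 1) ∧ Q.eval 0 ≠ 0 ∧
      lineRestr z (h + ρ) (Matrix.det (Matrix.of fun i j : Fin d =>
        polyAct (↑(e i) : GL (Fin n) ℂ) (p j))) = Polynomial.X ^ N * Q := by
  classical
  have : Fintype (G ⧸ S) := Fintype.ofFinite _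
  obtain ⟨m, hm⟩ : ∃ m, m = Nat.card S := ⟨_, rfl⟩
  have hm0 : 0 < m := hm ▸ Nat.card_pos
  have hχm' : ∀ g, χ g ^ m = 1 := hm ▸ hχm
  let η : Fin m ≃ S := hm ▸ (Finite.equivFin S).symm
  let f : Fin m × (G ⧸ S) ≃ Fin d :=
    ((Equiv.ofBijective _ (bijective_out_mul_of_equiv S η)).trans (Equiv.inv G)).trans e.symm
  have hf : ∀ x, e (f x) = ((Quotient.out x.2 : G) * (η x.1 : G))⁻¹ := fun x => by simp [f]
  let τ : G ⧸ S → GL (Fin n) ℂ := fun s => ((Quotient.out s : G) : GL (Fin n) ℂ)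
  let A := Matrix.of fun i j : Fin d => polyAct (↑(e i) : GL (Fin n) ℂ) (p j)
  let V := Matrix.blockDiagonal fun _ : G ⧸ S => Matrix.of fun k a : Fin m =>
    (Polynomial.C (χ (η k)) ^ (a : ℕ) * Polynomial.X ^ (a : ℕ) : Polynomial ℂ)
  let B : Matrix (Fin m × (G ⧸ S)) (Fin m × (G ⧸ S)) (Polynomial ℂ) := Matrix.of fun x y =>
    residuePart m (x.1 : ℕ) Polynomial.X
      (planeRestr (gAct (τ x.2) z) (gAct (τ x.2) h) (gAct (τ x.2) ρ) (p (f y)))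
  have hentry : ∀ x (q : MvPolynomial (Fin n) ℂ),
      lineRestr z (h + ρ) (polyAct (e (f x) : GL (Fin n) ℂ) q) =
        lineRestr (gAct (τ x.2) z) (gAct (τ x.2) h + χ (η x.1) • gAct (τ x.2) ρ) q := by
    intro x q
    rw [lineRestr_polyAct, hf]
    have h1 : ((((Quotient.out x.2 : G) * (η x.1 : G))⁻¹ : G) : GL (Fin n) ℂ)⁻¹ =
        τ x.2 * ((η x.1 : G) : GL (Fin n) ℂ) := by
      simp [τ]
    rw [h1, gAct_mul, gAct_mul, (hS _).mp (η x.1).2, gAct_add, hh, hρ, gAct_add, gAct_smul]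
  have hVB : (lineRestr z (h + ρ)).mapMatrix (A.submatrix f f) = V * B := by
    refine Matrix.ext fun x y => ?_
    obtain ⟨k, s⟩ := x
    have h1 : (lineRestr z (h + ρ)).mapMatrix (A.submatrix f f) (k, s) y =
        lineRestr z (h + ρ) (polyAct (e (f (k, s)) : GL (Fin n) ℂ) (p (f y))) := rfl
    rw [h1, hentry, ← eval_planeRestr, eval_mul_eq_sum_residuePart hm0 _ _
      (by rw [← Polynomial.C_pow, hχm', Polynomial.C_1]), Matrix.mul_apply,
      Fintype.sum_prod_type]
    refine Finset.sum_congr rfl fun a _ => ?_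
    rw [Finset.sum_eq_single s]
    · simp [V, B, Matrix.blockDiagonal_apply]
    · intro s' _ hs'
      simp [V, Matrix.blockDiagonal_apply, hs'.symm]
    · simp
  have hB : (B.det).eval 0 ≠ 0 := by
    have hmap : (B.det).eval 0 = ((Polynomial.evalRingHom 0).mapMatrix B).det := by
      rw [← RingHom.map_det]; rfl
    rw [hmap]
    intro hdet
    obtain ⟨c, hc0, hc⟩ := Matrix.exists_vecMul_eq_zero_iff.mpr hdet
    refine hc0 (eq_zero_of_forall_sum_coeff_lineRestr (fun s => gAct (τ s) z)
      (fun s => gAct (τ s) ρ) ?_ ?_ c ?_)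
    · intro s s' hss
      have h1 : (Quotient.out s)⁻¹ * Quotient.out s' ∈ S := by
        rw [hS]
        have h2 : gAct (τ s) z = gAct (τ s') z := hss
        have h3 : (((Quotient.out s)⁻¹ * Quotient.out s' : G) : GL (Fin n) ℂ) =
          (τ s)⁻¹ * τ s' := rfl
        rw [h3, gAct_mul, ← h2, gAct_inv_gAct]
      rwa [← QuotientGroup.eq, QuotientGroup.out_eq', QuotientGroup.out_eq'] at h1
    · intro h1 s h0
      exact hρ0 (hm ▸ h1) (gAct_injective (τ s) (h0.trans (gAct_zero _).symm))
    · have hp : ∀ j, ∑ x : Fin m × (G ⧸ S),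
          c x * (lineRestr (gAct (τ x.2) z) (gAct (τ x.2) ρ) (p j)).coeff x.1 = 0 := by
        intro j
        have h1 := congrFun hc (f.symm j)
        rw [Matrix.vecMul, dotProduct] at h1
        refine Eq.trans ?_ h1
        refine Finset.sum_congr rfl fun x _ => ?_
        congr 1
        have h2 : (Polynomial.evalRingHom 0).mapMatrix B x (f.symm j) =
          (B x (f.symm j)).eval 0 := rfl
        rw [h2]
        simp only [B, Matrix.of_apply]
        rw [eval_zero_residuePart m _ x.1.isLt, f.apply_symm_apply, ← map_planeRestr,
          Polynomial.coeff_map]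
        rfl
      intro q
      obtain ⟨r, hr, rfl⟩ := hspan q
      have hcoeff : ∀ x : Fin m × (G ⧸ S), ∀ j,
          (lineRestr (gAct (τ x.2) z) (gAct (τ x.2) ρ) (r j * p j)).coeff x.1 =
            (lineRestr z ρ (r j)).coeff 0 *
              (lineRestr (gAct (τ x.2) z) (gAct (τ x.2) ρ) (p j)).coeff x.1 := by
        intro x j
        have h1 : lineRestr (gAct (τ x.2) z) (gAct (τ x.2) ρ) (r j) = lineRestr z ρ (r j) := by
          have h2 := lineRestr_polyAct z ρ (τ x.2)⁻¹ (r j)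
          rw [inv_inv, hr j _ (G.inv_mem (Quotient.out x.2).2)] at h2
          exact h2.symm
        rw [map_mul, h1]
        refine coeff_mul_of_coeff_eq_zero (m := m) (fun k hk hkm => ?_) x.1.isLt
        refine coeff_eq_zero_of_forall_comp_eq χ hχ _ (fun g => ?_) hk (hm ▸ hkm)
        have h2 := lineRestr_polyAct z ρ ((g : G) : GL (Fin n) ℂ)⁻¹ (r j)
        rw [inv_inv, hr j _ (G.inv_mem (g : G).2), (hS _).mp g.2, hρ] at h2
        rw [← lineRestr_smul, ← h2]
      simp only [map_sum, Polynomial.finsetSum_coeff, hcoeff, Finset.mul_sum]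
      rw [Finset.sum_comm]
      refine Finset.sum_eq_zero fun j _ => ?_
      rw [← mul_zero ((lineRestr z ρ (r j)).coeff 0), ← hp j, Finset.mul_sum]
      exact Finset.sum_congr rfl fun x _ => by ring
  have hdet : lineRestr z (h + ρ) A.det = V.det * B.det := by
    rw [← Matrix.det_mul, ← hVB, ← AlgHom.map_det, Matrix.det_submatrix_equiv_self]
  rw [det_blockDiagonal_vandermonde_X, mul_assoc] at hdet
  refine ⟨_, _, ?_, ?_, hdet⟩
  · have hd : d = Fintype.card (G ⧸ S) * m := by
      rw [hm, ← Nat.card_eq_fintype_card, ← Subgroup.card_eq_card_quotient_mul_card_subgroup,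
        ← Nat.card_congr e, Nat.card_eq_fintype_card, Fintype.card_fin]
    rw [← hm, ← mul_assoc, mul_comm 2, Finset.sum_range_id_mul_two, hd]
    ring
  · rw [Polynomial.eval_mul, Polynomial.eval_C]
    refine mul_ne_zero (pow_ne_zero _ ?_) hB
    exact Matrix.det_vandermonde_ne_zero_iff.mpr (hχ.comp η.injective)

theorem lineRestr_zero_of_isHomogeneous {n k : ℕ} {P : MvPolynomial (Fin n) ℂ}
    (hP : P.IsHomogeneous k) (v : Fin n → ℂ) :
    lineRestr 0 v P = Polynomial.C (eval v P) * Polynomial.X ^ k := by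
  apply Polynomial.funext
  intro t
  rw [eval_lineRestr, zero_add, Polynomial.eval_mul, Polynomial.eval_C, Polynomial.eval_pow,
    Polynomial.eval_X, mul_comm]
  rw [eval_eq, eval_eq, Finset.mul_sum]
  refine Finset.sum_congr rfl fun s hs => ?_
  simp only [Pi.smul_apply, smul_eq_mul, mul_pow, Finset.prod_mul_distrib,
    Finset.prod_pow_eq_pow_sum, hP.degree_eq_sum_deg_support hs]
  ring

theorem coeff_lineRestr_zero {n : ℕ} (v : Fin n → ℂ) (P : MvPolynomial (Fin n) ℂ) (i : ℕ) :
    (lineRestr 0 v P).coeff i = eval v (homogeneousComponent i P) := by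
  conv_lhs => rw [← sum_homogeneousComponent P]
  simp only [map_sum, Polynomial.finsetSum_coeff,
    lineRestr_zero_of_isHomogeneous (homogeneousComponent_isHomogeneous _ P),
    Polynomial.coeff_C_mul_X_pow]
  rw [Finset.sum_ite_eq]
  split_ifs with h
  · rfl
  · rw [homogeneousComponent_eq_zero _ _ (by simpa using h), map_zero]

theorem eq_C_mul_X_pow_of_forall_ne_zero {F : Polynomial ℂ} (hF : ∀ s, s ≠ 0 → F.eval s ≠ 0) :
    ∃ c N, F = Polynomial.C c * Polynomial.X ^ N := by
  have h0 : F ≠ 0 := fun h => hF 1 one_ne_zero (by simp [h])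
  have hroots : F.roots = Multiset.replicate (Multiset.card F.roots) 0 := by
    rw [Multiset.eq_replicate]
    refine ⟨rfl, fun b hb => ?_⟩
    by_contra hne
    exact hF b hne ((Polynomial.mem_roots h0).mp hb)
  refine ⟨F.leadingCoeff, Multiset.card F.roots, ?_⟩
  conv_lhs => rw [(IsAlgClosed.splits F).eq_prod_roots, hroots]
  simp

/-- A polynomial without zeros on the punctured lines through the points where `l` does not
vanish is homogeneous. -/
theorem exists_isHomogeneous_of_forall_smul_eval_ne_zero {n : ℕ}
    {D l : MvPolynomial (Fin n) ℂ} (hl : l ≠ 0)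
    (hD : ∀ v, eval v l ≠ 0 → ∀ s : ℂ, s ≠ 0 → eval (s • v) D ≠ 0) :
    ∃ k, D.IsHomogeneous k := by
  by_cases hex : ∃ k, homogeneousComponent k D ≠ 0
  · obtain ⟨k, hk⟩ := hex
    have hzero : ∀ i, i ≠ k → homogeneousComponent i D = 0 := by
      intro i hik
      have hprod : homogeneousComponent i D * homogeneousComponent k D * l = 0 := by
        apply MvPolynomial.funext
        intro v
        rw [map_mul, map_mul, map_zero]
        by_cases hv : eval v l = 0
        · rw [hv, mul_zero]
        · obtain ⟨c, N, hF⟩ := eq_C_mul_X_pow_of_forall_ne_zero (F := lineRestr 0 v D)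
            fun s hs => by
              rw [eval_lineRestr, zero_add]
              exact hD v hv s hs
          rw [← coeff_lineRestr_zero, ← coeff_lineRestr_zero, hF, Polynomial.coeff_C_mul_X_pow,
            Polynomial.coeff_C_mul_X_pow]
          by_cases hiN : i = N
          · rw [if_neg fun h : k = N => hik (hiN.trans h.symm), mul_zero, zero_mul]
          · rw [if_neg hiN, zero_mul, zero_mul]
      rcases mul_eq_zero.mp hprod with h | h
      · exact (mul_eq_zero.mp h).resolve_right hk
      · exact absurd h hl
    refine ⟨k, ?_⟩
    have hDk : D = homogeneousComponent k D := by
      conv_lhs => rw [← sum_homogeneousComponent D]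
      refine Finset.sum_eq_single k (fun i _ hi => hzero i hi) fun h => ?_
      exact homogeneousComponent_eq_zero _ _ (by simpa using h)
    rw [hDk]
    exact homogeneousComponent_isHomogeneous _ _
  · push Not at hex
    refine ⟨0, ?_⟩
    rw [← sum_homogeneousComponent D, Finset.sum_eq_zero fun i _ => hex i]
    exact isHomogeneous_zero _ _ _

theorem natDegree_lineRestr_prod_X_pow_le {n : ℕ} (u v : Fin n → ℂ) (s : Fin n →₀ ℕ)
    (I : Finset (Fin n)) :
    (lineRestr u v (∏ i ∈ I, X i ^ s i)).natDegree ≤ ∑ i ∈ I, s i ∧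
      (lineRestr u v (∏ i ∈ I, X i ^ s i)).coeff (∑ i ∈ I, s i) =
        eval v (∏ i ∈ I, X i ^ s i) := by
  classical
  have hX : ∀ i, (lineRestr u v (X i)).natDegree ≤ 1 := fun i => by
    rw [lineRestr_X]
    compute_degree
  have hXc : ∀ i, (lineRestr u v (X i)).coeff 1 = v i := fun i => by
    rw [lineRestr_X]
    simp [Polynomial.coeff_C]
  induction I using Finset.induction_on with
  | empty => simp
  | insert i I hi ih =>
    have h1 : (lineRestr u v (X i ^ s i)).natDegree ≤ s i := by
      rw [map_pow]
      simpa using Polynomial.natDegree_pow_le_of_le (s i) (hX i)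
    have h2 : (lineRestr u v (X i ^ s i)).coeff (s i) = v i ^ s i := by
      rw [map_pow, ← hXc]
      simpa using Polynomial.coeff_pow_of_natDegree_le (m := s i) (hX i)
    rw [Finset.prod_insert hi, Finset.sum_insert hi, map_mul, map_mul]
    refine ⟨Polynomial.natDegree_mul_le_of_le h1 ih.1, ?_⟩
    rw [Polynomial.coeff_mul_add_eq_of_natDegree_le h1 ih.1, h2, ih.2]
    simp

theorem natDegree_lineRestr_of_isHomogeneous {n k : ℕ} {P : MvPolynomial (Fin n) ℂ}
    (hP : P.IsHomogeneous k) (u v : Fin n → ℂ) (hv : eval v P ≠ 0) :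
    (lineRestr u v P).natDegree = k := by
  have hmon : ∀ s ∈ P.support, (lineRestr u v (monomial s (P.coeff s))).natDegree ≤ k ∧
      (lineRestr u v (monomial s (P.coeff s))).coeff k = eval v (monomial s (P.coeff s)) := by
    intro s hs
    have hk : ∑ i ∈ s.support, s i = k := (hP.degree_eq_sum_deg_support hs).symm
    obtain ⟨h1, h2⟩ := natDegree_lineRestr_prod_X_pow_le u v s s.support
    rw [hk] at h1 h2
    rw [monomial_eq, Finsupp.prod, map_mul, lineRestr_C, map_mul, eval_C, Polynomial.coeff_C_mul, h2]
    exact ⟨(Polynomial.natDegree_C_mul_le _ _).trans h1, rfl⟩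
  have hle : (lineRestr u v P).natDegree ≤ k := by
    conv_lhs => rw [P.as_sum, map_sum]
    exact Polynomial.natDegree_sum_le_of_forall_le _ _ fun s hs => (hmon s hs).1
  have hco : (lineRestr u v P).coeff k = eval v P := by
    conv_lhs => rw [P.as_sum, map_sum, Polynomial.finsetSum_coeff]
    conv_rhs => rw [P.as_sum, map_sum]
    exact Finset.sum_congr rfl fun s hs => (hmon s hs).2
  exact Polynomial.natDegree_eq_of_le_of_coeff_ne_zero hle (hco ▸ hv)

/-- The subspace of fixed points of an invertible matrix. -/
def fixedSubspace {n : ℕ} (σ : GL (Fin n) ℂ) : Submodule ℂ (Fin n → ℂ) :=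
  LinearMap.ker (Matrix.mulVecLin (1 - (σ : Matrix (Fin n) (Fin n) ℂ)))

theorem mem_fixedSubspace {n : ℕ} {σ : GL (Fin n) ℂ} {z : Fin n → ℂ} :
    z ∈ fixedSubspace σ ↔ gAct σ z = z := by
  rw [fixedSubspace, LinearMap.mem_ker, Matrix.mulVecLin_apply, Matrix.sub_mulVec,
    Matrix.one_mulVec, sub_eq_zero, eq_comm, gAct]

theorem exists_ne_zero_forall_gAct_ne {n : ℕ} (G : Subgroup (GL (Fin n) ℂ)) [Finite G] :
    ∃ l : MvPolynomial (Fin n) ℂ, l ≠ 0 ∧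
      ∀ z, eval z l ≠ 0 → ∀ g : G, gAct (g : GL (Fin n) ℂ) z = z → g = 1 := by
  classical
  have := Fintype.ofFinite G
  have key : ∀ g : G, ∃ l : MvPolynomial (Fin n) ℂ, l ≠ 0 ∧
      (gAct (g : GL (Fin n) ℂ) ≠ id → ∀ z, eval z l ≠ 0 → gAct (g : GL (Fin n) ℂ) z ≠ z) := by
    intro g
    by_cases hg : gAct (g : GL (Fin n) ℂ) = id
    · exact ⟨1, one_ne_zero, fun h => absurd hg h⟩
    · obtain ⟨z, hz⟩ := Function.ne_iff.mp hg
      obtain ⟨i, hi⟩ := Function.ne_iff.mp hz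
      let A := ((g : GL (Fin n) ℂ) : Matrix (Fin n) (Fin n) ℂ)
      let l : MvPolynomial (Fin n) ℂ := (∑ j, C (A i j) * X j) - X i
      have hl : ∀ w, eval w l = gAct (g : GL (Fin n) ℂ) w i - w i := by
        intro w
        simp [l, A, gAct, Matrix.mulVec, dotProduct]
      refine ⟨l, fun h => hi ?_, fun _ w hw hgw => hw ?_⟩
      · have := hl z
        rw [h, map_zero] at this
        exact (sub_eq_zero.mp this.symm)
      · rw [hl, hgw, sub_self]
  choose l hl0 hl using key
  refine ⟨∏ g, l g, Finset.prod_ne_zero_iff.mpr fun g _ => hl0 g, fun z hz g hgz => ?_⟩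
  rw [map_prod, Finset.prod_ne_zero_iff] at hz
  by_contra hne
  refine hl g (fun hid => hne ?_) z (hz g (Finset.mem_univ g)) hgz
  apply Subtype.ext
  apply Units.ext
  refine Matrix.mulVec_injective (funext fun w => ?_)
  rw [OneMemClass.coe_one, Units.val_one, Matrix.one_mulVec]
  exact congrFun hid w

/-- If `v` has trivial stabilizer and the elements of `S` fix a common hyperplane, then `v`
splits into an `S`-fixed vector and a vector on which `S` acts by an injective character. -/
theorem exists_fixed_add_eigenvector {n : ℕ} {G : Subgroup (GL (Fin n) ℂ)} [Finite G]
    (S : Subgroup G) {v : Fin n → ℂ} (hv : ∀ g : G, gAct (g : GL (Fin n) ℂ) v = v → g = 1)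
    (hfix : ∀ g ∈ S, ∀ g' ∈ S, (fixedSubspace (g : GL (Fin n) ℂ) ⊓
      fixedSubspace (g' : GL (Fin n) ℂ)) ⊔ Submodule.span ℂ {v} = ⊤) :
    ∃ (h ρ : Fin n → ℂ) (χ : S → ℂ), v = h + ρ ∧ Function.Injective χ ∧
      (∀ g, χ g ^ Nat.card S = 1) ∧
      (∀ g : S, gAct ((g : G) : GL (Fin n) ℂ) h = h) ∧
      (∀ g : S, gAct ((g : G) : GL (Fin n) ℂ) ρ = χ g • ρ) ∧
      (1 < Nat.card S → ρ ≠ 0) := by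
  classical
  have := Fintype.ofFinite S
  let a : S → (Fin n → ℂ) →ₗ[ℂ] (Fin n → ℂ) := fun g =>
    Matrix.mulVecLin (((g : G) : GL (Fin n) ℂ) : Matrix (Fin n) (Fin n) ℂ)
  have ha : ∀ g x, a g x = gAct ((g : G) : GL (Fin n) ℂ) x := fun g x => rfl
  have hamul : ∀ g g' x, a (g * g') x = a g (a g' x) := fun g g' x => gAct_mul _ _ _
  have haone : ∀ x, a 1 x = x := gAct_one
  let A : (Fin n → ℂ) →ₗ[ℂ] (Fin n → ℂ) := (Nat.card S : ℂ)⁻¹ • ∑ g, a g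
  have hA : ∀ x, A x = (Nat.card S : ℂ)⁻¹ • ∑ g, a g x := fun x => by simp [A]
  have hcard : (Nat.card S : ℂ) ≠ 0 := Nat.cast_ne_zero.mpr Nat.card_pos.ne'
  have hAa : ∀ g x, A (a g x) = A x := by
    intro g x
    rw [hA, hA, ← Equiv.sum_comp (Equiv.mulRight g) fun g' => a g' x]
    simp [hamul]
  have haA : ∀ g x, a g (A x) = A x := by
    intro g x
    rw [hA, map_smul, map_sum, ← Equiv.sum_comp (Equiv.mulLeft g) fun g' => a g' x]
    simp [hamul]
  have hAfix : ∀ x, (∀ g, a g x = x) → A x = x := by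
    intro x hx
    rw [hA, Finset.sum_congr rfl fun g _ => hx g, Finset.sum_const, Finset.card_univ,
      ← Nat.card_eq_fintype_card, ← Nat.cast_smul_eq_nsmul ℂ, inv_smul_smul₀ hcard]
  have hvS : ∀ g : S, a g v = v → g = 1 := fun g hg => Subtype.ext (hv g hg)
  have hAρ : A (v - A v) = 0 := by
    rw [map_sub, hAfix (A v) fun g => haA g v, sub_self]
  have hsplit : A v + (v - A v) = v := add_sub_cancel _ _
  have heig : ∀ g : S, ∃ c : ℂ, a g (v - A v) = c • (v - A v) := by
    intro g
    by_cases hg : g = 1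
    · exact ⟨1, by rw [hg, haone, one_smul]⟩
    · have hH : ∀ x ∈ fixedSubspace ((g : G) : GL (Fin n) ℂ), ∀ g' : S, a g' x = x := by
        intro x hx g'
        obtain ⟨y, hy, w, hw, rfl⟩ := Submodule.mem_sup.mp
          ((hfix g g.2 g' g'.2).symm ▸ Submodule.mem_top : x ∈ _)
        obtain ⟨c, rfl⟩ := Submodule.mem_span_singleton.mp hw
        have hcv : c • v ∈ fixedSubspace ((g : G) : GL (Fin n) ℂ) := by
          have := Submodule.sub_mem _ hx hy.1
          rwa [add_sub_cancel_left] at this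
        by_cases hc : c = 0
        · rw [hc, zero_smul, add_zero]
          exact mem_fixedSubspace.mp hy.2
        · have hv' := (Submodule.smul_mem_iff _ hc).mp hcv
          exact absurd (hvS g (mem_fixedSubspace.mp hv')) hg
      obtain ⟨y, hy, w, hw, hyw⟩ := Submodule.mem_sup.mp
        ((hfix g g.2 g g.2).symm ▸ Submodule.mem_top : a g v ∈ _)
      obtain ⟨c, rfl⟩ := Submodule.mem_span_singleton.mp hw
      refine ⟨c, ?_⟩
      have h1 : a g (v - A v) = (y + c • A v - A v) + c • (v - A v) := by
        rw [map_sub, haA, ← hyw]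
        module
      have h2 : A (y + c • A v - A v) = y + c • A v - A v := by
        refine hAfix _ fun g' => ?_
        rw [map_sub, map_add, map_smul, haA, hH y hy.1]
      have h3 := congrArg A h1
      rw [hAa, map_add, map_smul, hAρ, smul_zero, add_zero, h2] at h3
      rw [h1, ← h3, zero_add]
  have heig' : ∀ g : S, ∃ c : ℂ, a g (v - A v) = c • (v - A v) ∧ c ^ Nat.card S = 1 := by
    intro g
    by_cases hρ : v - A v = 0
    · exact ⟨1, by rw [hρ, map_zero, smul_zero], one_pow _⟩
    · obtain ⟨c, hc⟩ := heig g
      refine ⟨c, hc, ?_⟩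
      have hpow : ∀ k : ℕ, a (g ^ k) (v - A v) = c ^ k • (v - A v) := by
        intro k
        induction k with
        | zero => rw [pow_zero, pow_zero, haone, one_smul]
        | succ k ih => rw [pow_succ, hamul, hc, map_smul, ih, smul_smul, pow_succ, mul_comm]
      have h1 := hpow (Nat.card S)
      rw [pow_card_eq_one', haone] at h1
      exact smul_left_injective ℂ hρ ((h1.symm.trans (one_smul ℂ _).symm))
  choose χ hχ hχm using heig'
  refine ⟨A v, v - A v, χ, hsplit.symm, ?_, hχm, fun g => haA g v, hχ, ?_⟩
  · intro g g' hgg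
    have h1 : a g v = a g' v := by
      rw [← hsplit, map_add, map_add, haA, haA, hχ, hχ, hgg]
    have h2 : a (g'⁻¹ * g) v = v := by
      rw [hamul, h1, ← hamul, inv_mul_cancel, haone]
    exact (inv_mul_eq_one.mp (hvS _ h2)).symm
  · intro hS h0
    obtain ⟨g, hg⟩ : ∃ g : S, g ≠ 1 := by
      have := Finite.one_lt_card_iff_nontrivial.mp hS
      exact exists_ne 1
    refine hg (hvS g ?_)
    rw [sub_eq_zero.mp h0, haA]

theorem rootMultiplicity_zero_X_pow_mul {Q : Polynomial ℂ} (hQ : Q.eval 0 ≠ 0) (N : ℕ) :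
    (Polynomial.X ^ N * Q).rootMultiplicity 0 = N := by
  have hQ0 : Q ≠ 0 := fun h => hQ (by simp [h])
  have h := Polynomial.rootMultiplicity_X_sub_C_pow (0 : ℂ) N
  rw [Polynomial.C_0, sub_zero] at h
  rw [Polynomial.rootMultiplicity_mul (mul_ne_zero (pow_ne_zero _ Polynomial.X_ne_zero) hQ0), h,
    Polynomial.rootMultiplicity_eq_zero hQ, add_zero]

/-- The stabilizer in `G` of a point of `ℂⁿ`. -/
def pointStabilizer {n : ℕ} (G : Subgroup (GL (Fin n) ℂ)) (z : Fin n → ℂ) : Subgroup G where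
  carrier := {g | gAct (g : GL (Fin n) ℂ) z = z}
  one_mem' := gAct_one z
  mul_mem' {g g'} hg hg' := by
    have hg : gAct (g : GL (Fin n) ℂ) z = z := hg
    have hg' : gAct (g' : GL (Fin n) ℂ) z = z := hg'
    change gAct ((g : GL (Fin n) ℂ) * (g' : GL (Fin n) ℂ)) z = z
    rw [gAct_mul, hg', hg]
  inv_mem' {g} hg := by
    have hg : gAct (g : GL (Fin n) ℂ) z = z := hg
    change gAct (g : GL (Fin n) ℂ)⁻¹ z = z
    conv_lhs => rw [← hg]
    exact gAct_inv_gAct _ _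

theorem mem_pointStabilizer {n : ℕ} {G : Subgroup (GL (Fin n) ℂ)} {z : Fin n → ℂ} (g : G) :
    g ∈ pointStabilizer G z ↔ gAct (g : GL (Fin n) ℂ) z = z := Iff.rfl

theorem eval_det_ne_zero {n : ℕ} (G : Subgroup (GL (Fin n) ℂ)) [Finite G] {d : ℕ}
    (e : Fin d ≃ G) (p : Fin d → MvPolynomial (Fin n) ℂ)
    (hspan : ∀ q : MvPolynomial (Fin n) ℂ, ∃ r : Fin d → MvPolynomial (Fin n) ℂ,
      (∀ i, ∀ σ ∈ G, polyAct σ (r i) = r i) ∧ q = ∑ i, r i * p i)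
    (z : Fin n → ℂ) (hz : ∀ g : G, gAct (g : GL (Fin n) ℂ) z = z → g = 1) :
    eval z (Matrix.det (Matrix.of fun i j : Fin d =>
      polyAct (↑(e i) : GL (Fin n) ℂ) (p j))) ≠ 0 := by
  have hS : ∀ g : (⊥ : Subgroup G), g = 1 := fun g => Subsingleton.elim _ _
  obtain ⟨N, Q, hN, hQ, hNQ⟩ := exists_lineRestr_det_eq G e p hspan z 0 0 ⊥
    (fun g => by
      rw [Subgroup.mem_bot]
      exact ⟨fun h => h ▸ gAct_one z, hz g⟩)
    (fun _ => 1) (fun g g' _ => Subsingleton.elim _ _) (fun _ => one_pow _)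
    (fun g => gAct_zero _) (fun g => by rw [gAct_zero, smul_zero]) (fun h => by simp at h)
  have hN0 : N = 0 := by
    rw [Subgroup.card_bot] at hN
    omega
  have h := congrArg (Polynomial.eval 0) hNQ
  rw [eval_lineRestr, hN0, pow_zero, one_mul, zero_smul, add_zero] at h
  rw [h]
  exact hQ

theorem exists_forall_add_smul_notMem {n : ℕ} (v : Fin n → ℂ) {ι : Type*} [Finite ι]
    (W : ι → Submodule ℂ (Fin n → ℂ)) :
    ∃ u : Fin n → ℂ, ∀ i, ∀ t : ℂ, u + t • v ∈ W i → W i ⊔ Submodule.span ℂ {v} = ⊤ := by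
  obtain ⟨u, hu⟩ := Submodule.exists_forall_notMem_of_forall_ne_top
    (fun i : {i // W i ⊔ Submodule.span ℂ {v} ≠ ⊤} => W i ⊔ Submodule.span ℂ {v}) fun i => i.2
  refine ⟨u, fun i t ht => ?_⟩
  by_contra hne
  refine hu ⟨i, hne⟩ ?_
  have h : u = (u + t • v) - t • v := by module
  rw [h]
  exact Submodule.sub_mem _ (Submodule.mem_sup_left ht)
    (Submodule.mem_sup_right (Submodule.smul_mem _ _ (Submodule.mem_span_singleton_self v)))

theorem existsUnique_add_smul_mem_fixedSubspace {n : ℕ} {σ : GL (Fin n) ℂ} {v : Fin n → ℂ}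
    (hv : v ∉ fixedSubspace σ)
    (hσ : Matrix.rank ((1 : Matrix (Fin n) (Fin n) ℂ) - (σ : Matrix (Fin n) (Fin n) ℂ)) = 1)
    (u : Fin n → ℂ) : ∃! t : ℂ, u + t • v ∈ fixedSubspace σ := by
  set T := Matrix.mulVecLin (1 - (σ : Matrix (Fin n) (Fin n) ℂ)) with hT
  have hmem : ∀ x, x ∈ fixedSubspace σ ↔ T x = 0 := fun x => Iff.rfl
  have hv0 : T v ≠ 0 := hv
  rw [Matrix.rank, ← hT] at hσ
  have hne : (⟨T v, v, rfl⟩ : LinearMap.range T) ≠ 0 := fun h => hv0 (congrArg Subtype.val h)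
  obtain ⟨c, hc⟩ := (finrank_eq_one_iff_of_nonzero' _ hne).mp hσ ⟨T u, u, rfl⟩
  have hc' : c • T v = T u := congrArg Subtype.val hc
  refine ⟨-c, ?_, fun t ht => ?_⟩
  · simp only [hmem, map_add, map_smul, ← hc']
    module
  · have ht : u + t • v ∈ fixedSubspace σ := ht
    rw [hmem, map_add, map_smul, ← hc', ← add_smul] at ht
    have := (smul_eq_zero.mp ht).resolve_right hv0
    linear_combination this

theorem rank_one_sub_eq_one {n : ℕ} {σ : GL (Fin n) ℂ} {v : Fin n → ℂ}
    (hv : v ∉ fixedSubspace σ) (hσ : fixedSubspace σ ⊔ Submodule.span ℂ {v} = ⊤) :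
    Matrix.rank ((1 : Matrix (Fin n) (Fin n) ℂ) - (σ : Matrix (Fin n) (Fin n) ℂ)) = 1 := by
  set T := Matrix.mulVecLin (1 - (σ : Matrix (Fin n) (Fin n) ℂ)) with hT
  have hv0 : T v ≠ 0 := hv
  have hrange : LinearMap.range T = Submodule.span ℂ {T v} := by
    have hker : Submodule.map T (fixedSubspace σ) = ⊥ := by
      rw [Submodule.eq_bot_iff]
      rintro _ ⟨x, hx, rfl⟩
      exact hx
    rw [LinearMap.range_eq_map, ← hσ, Submodule.map_sup, Submodule.map_span,
      Set.image_singleton, hker, bot_sup_eq]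
  rw [Matrix.rank, ← hT, hrange, finrank_span_singleton hv0]

theorem card_pointStabilizer_sub_one {n : ℕ} (G : Subgroup (GL (Fin n) ℂ)) [Fintype G]
    (z : Fin n → ℂ)
    [DecidablePred fun g : G => g ≠ 1 ∧ gAct (g : GL (Fin n) ℂ) z = z] :
    Nat.card (pointStabilizer G z) - 1 =
      (Finset.univ.filter fun g : G => g ≠ 1 ∧ gAct (g : GL (Fin n) ℂ) z = z).card := by
  classical
  have h : (Finset.univ.filter fun g : G => g ≠ 1 ∧ gAct (g : GL (Fin n) ℂ) z = z) =
      (Finset.univ.filter fun g : G => g ∈ pointStabilizer G z).erase 1 := by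
    ext g
    simp [mem_pointStabilizer]
  rw [h, Finset.card_erase_of_mem (by simp), Nat.card_eq_fintype_card, Fintype.card_subtype]

/-- For a finite pseudoreflection group `G` of order `d` containing `m` pseudoreflections and
a basis `p₁,…,p_d` of `ℂ[z]` over `ℂ[z]^G`, the determinant of the matrix `Λ = ((ρᵢ·p_j))`
is a homogeneous polynomial of degree `d·m/2`. -/
theorem det_Lambda_homogeneous {n : ℕ} (G : Subgroup (GL (Fin n) ℂ)) [Finite G]
    (hG : IsPseudoreflectionGroup G) (d : ℕ) (e : Fin d ≃ G)
    (p : Fin d → MvPolynomial (Fin n) ℂ)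
    (hbasis_ex : ∀ q : MvPolynomial (Fin n) ℂ, ∃ r : Fin d → MvPolynomial (Fin n) ℂ,
      (∀ i, ∀ σ ∈ G, polyAct σ (r i) = r i) ∧ q = ∑ i, r i * p i)
    (hbasis_uniq : ∀ r r' : Fin d → MvPolynomial (Fin n) ℂ,
      (∀ i, ∀ σ ∈ G, polyAct σ (r i) = r i) → (∀ i, ∀ σ ∈ G, polyAct σ (r' i) = r' i) →
      ∑ i, r i * p i = ∑ i, r' i * p i → r = r')
    (m : ℕ) (hm : m = Set.ncard {σ : GL (Fin n) ℂ | σ ∈ G ∧ IsPseudoreflection σ}) :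
    ∃ k : ℕ, 2 * k = d * m ∧
      (Matrix.det (Matrix.of fun i j : Fin d =>
        polyAct (↑(e i) : GL (Fin n) ℂ) (p j))).IsHomogeneous k := by
  classical
  have := Fintype.ofFinite G
  set D := Matrix.det (Matrix.of fun i j : Fin d => polyAct (↑(e i) : GL (Fin n) ℂ) (p j)) with hDdef
  obtain ⟨l, hl0, hl⟩ := exists_ne_zero_forall_gAct_ne G
  have hfree : ∀ v, (∀ g : G, gAct (g : GL (Fin n) ℂ) v = v → g = 1) → eval v D ≠ 0 :=
    eval_det_ne_zero G e p hbasis_ex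
  obtain ⟨k, hk⟩ : ∃ k, D.IsHomogeneous k := by
    refine exists_isHomogeneous_of_forall_smul_eval_ne_zero hl0 fun v hv s hs => ?_
    refine hfree _ fun g hg => hl v hv g ?_
    rw [gAct_smul] at hg
    exact smul_right_injective _ hs hg
  refine ⟨k, ?_, hk⟩
  obtain ⟨v, hlv⟩ : ∃ v, eval v l ≠ 0 := by
    by_contra! hcon
    exact hl0 (MvPolynomial.funext fun v => by rw [hcon, map_zero])
  have hv := hl v hlv
  have hvfix : ∀ g : G, g ≠ 1 → v ∉ fixedSubspace (g : GL (Fin n) ℂ) := fun g hg h =>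
    hg (hv g (mem_fixedSubspace.mp h))
  obtain ⟨u, hu⟩ := exists_forall_add_smul_notMem v fun x : G × G =>
    fixedSubspace (x.1 : GL (Fin n) ℂ) ⊓ fixedSubspace (x.2 : GL (Fin n) ℂ)
  set F := lineRestr u v D with hF
  have hmult : ∀ t : ℂ, 2 * F.rootMultiplicity t = d * (Finset.univ.filter fun g : G =>
      g ≠ 1 ∧ gAct (g : GL (Fin n) ℂ) (u + t • v) = u + t • v).card := by
    intro t
    obtain ⟨h, ρ, χ, hsum, hχ, hχm, hh, hρ, hρ0⟩ :=
      exists_fixed_add_eigenvector (pointStabilizer G (u + t • v)) hv fun g hg g' hg' =>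
        hu (g, g') t ⟨mem_fixedSubspace.mpr hg, mem_fixedSubspace.mpr hg'⟩
    obtain ⟨N, Q, hN, hQ, hNQ⟩ := exists_lineRestr_det_eq G e p hbasis_ex (u + t • v) h ρ
      (pointStabilizer G (u + t • v)) mem_pointStabilizer χ hχ hχm hh hρ hρ0
    rw [← hsum, ← hDdef, ← lineRestr_comp_X_add_C, ← hF] at hNQ
    rw [Polynomial.rootMultiplicity_eq_rootMultiplicity, hNQ, rootMultiplicity_zero_X_pow_mul hQ,
      hN, card_pointStabilizer_sub_one]
  have hdeg : F.natDegree = k := natDegree_lineRestr_of_isHomogeneous hk u v (hfree v hv)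
  have hroots : ∑ t ∈ F.roots.toFinset, F.rootMultiplicity t = k := by
    rw [← hdeg, ← Polynomial.splits_iff_card_roots.mp (IsAlgClosed.splits F),
      ← Multiset.toFinset_sum_count_eq]
    simp
  have hd : 0 < d := by
    have := Nat.card_congr e
    rw [Nat.card_eq_fintype_card, Fintype.card_fin] at this
    rw [this]
    exact Nat.card_pos
  have hcount : ∀ g : G, (F.roots.toFinset.filter fun t : ℂ =>
      g ≠ 1 ∧ gAct (g : GL (Fin n) ℂ) (u + t • v) = u + t • v).card =
        if IsPseudoreflection (g : GL (Fin n) ℂ) then 1 else 0 := by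
    intro g
    split_ifs with hg
    · have hg1 : g ≠ 1 := by
        rintro rfl
        simpa using hg.2
      obtain ⟨t, ht, huniq⟩ := existsUnique_add_smul_mem_fixedSubspace (hvfix g hg1) hg.2 u
      rw [Finset.card_eq_one]
      refine ⟨t, ?_⟩
      ext t'
      rw [Finset.mem_filter, Finset.mem_singleton]
      constructor
      · rintro ⟨-, -, ht'⟩
        exact huniq t' (mem_fixedSubspace.mpr ht')
      · rintro rfl
        have hgt := mem_fixedSubspace.mp ht
        refine ⟨?_, hg1, hgt⟩
        have hpos : 0 < (Finset.univ.filter fun g : G =>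
            g ≠ 1 ∧ gAct (g : GL (Fin n) ℂ) (u + t' • v) = u + t' • v).card :=
          Finset.card_pos.mpr ⟨g, by simpa using ⟨hg1, hgt⟩⟩
        have h2 := hmult t'
        rw [Multiset.mem_toFinset, ← Multiset.count_pos, Polynomial.count_roots]
        have := Nat.mul_pos hd hpos
        omega
    · rw [Finset.card_eq_zero, Finset.filter_eq_empty_iff]
      rintro t - ⟨hg1, hgt⟩
      have hmem := mem_fixedSubspace.mpr hgt
      have htop := hu (g, g) t ⟨hmem, hmem⟩
      rw [inf_idem] at htop
      refine hg ⟨?_, rank_one_sub_eq_one (hvfix g hg1) htop⟩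
      exact Submonoid.isOfFinOrder_coe.mpr (isOfFinOrder_of_finite g)
  have hm' : m = (Finset.univ.filter fun g : G =>
      IsPseudoreflection (g : GL (Fin n) ℂ)).card := by
    rw [hm, ← Set.ncard_coe_finset, ← Set.ncard_image_of_injective _ Subtype.val_injective]
    congr 1
    ext σ
    simp [and_comm]
  rw [← hroots, Finset.mul_sum, Finset.sum_congr rfl fun t _ => hmult t, ← Finset.mul_sum, hm',
    Finset.card_filter]
  congr 1
  rw [← Finset.sum_congr rfl fun g _ => hcount g]
  simp only [Finset.card_filter]
  exact Finset.sum_comm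
end
end

section
/- Let ρ ∈ GL(n,ℂ) be a pseudoreflection with reflecting hyperplane H = ker(Iₙ − ρ), and let L be a nonzero homogeneous linear polynomial with H = {z ∈ ℂⁿ : L(z) = 0}. Let N be a q×q matrix with entries in ℂ[z₁,…,zₙ] and let v be a q-tuple of polynomials. Suppose there exist j+1 distinct row indices i₀,…,i_j of N such that for each 0 ≤ t ≤ j the i_t-th row of N equals ρᵗ·v (the polynomial action of ρᵗ applied entrywise to v). Then L^{j(j+1)/2} divides det N in ℂ[z₁,…,zₙ]. -/
open MvPolynomial

noncomputable section

/-- If the `t`-th of `m` distinct rows of `N` is divisible by `L ^ t` modulo the span of the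
previous ones, then `L ^ (0 + 1 + ⋯ + (m - 1))` divides `det N`. -/
theorem pow_sum_dvd_det {R ι : Type*} [CommRing R] [Fintype ι] [DecidableEq ι] (L : R)
    (r : ℕ → ι) (m : ℕ) (hr : Set.InjOn r (Set.Iio m)) (N : Matrix ι ι R)
    (h : ∀ t < m, ∃ u ∈ Submodule.span R ((fun s => N (r s)) '' Set.Iio t),
      ∃ w : ι → R, N (r t) + u = L ^ t • w) :
    L ^ (∑ t ∈ Finset.range m, t) ∣ N.det := by
  induction m generalizing N with
  | zero => simp
  | succ m ih =>
    have hne : ∀ s < m, r s ≠ r m := fun s hs heq =>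
      hs.ne (hr (Set.mem_Iio.2 (hs.trans m.lt_succ_self)) (Set.mem_Iio.2 m.lt_succ_self) heq)
    obtain ⟨u, hu, w, hw⟩ := h m m.lt_succ_self
    have hdet : (N.updateRow (r m) u).det = 0 := by
      clear hw
      induction hu using Submodule.span_induction with
      | mem x hx =>
        obtain ⟨s, hs, rfl⟩ := hx
        refine Matrix.det_zero_of_row_eq (hne s hs) ?_
        rw [Matrix.updateRow_ne (hne s hs), Matrix.updateRow_self]
      | zero =>
        exact Matrix.det_eq_zero_of_row_eq_zero (r m) fun k => by simp
      | add x y _ _ hx hy => rw [Matrix.det_updateRow_add, hx, hy, add_zero]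
      | smul a x _ hx => rw [Matrix.det_updateRow_smul, hx, mul_zero]
    have hN : N.det = L ^ m * (N.updateRow (r m) w).det := by
      rw [← Matrix.det_updateRow_smul, ← hw, Matrix.det_updateRow_add, hdet, add_zero,
        Matrix.updateRow_eq_self]
    rw [Finset.sum_range_succ, pow_add, hN, mul_comm]
    refine mul_dvd_mul_left _ (ih (hr.mono (Set.Iio_subset_Iio m.le_succ)) _ fun t ht => ?_)
    obtain ⟨u', hu', w', hw'⟩ := h t (ht.trans m.lt_succ_self)
    refine ⟨u', ?_, w', ?_⟩
    · convert hu' using 2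
      refine Set.image_congr fun s hs => ?_
      exact Matrix.updateRow_ne (hne s (lt_trans hs ht))
    · rw [Matrix.updateRow_ne (hne t ht), hw']

/-- If `F` is the identity modulo `L` and `F (L • x) = c • L • F x`, then `F ^ t` applied to `v` is
divisible by `L ^ t` modulo the span of the lower iterates, by applying
`(F - 1) (F - c) ⋯ (F - c ^ (t - 1))`. -/
theorem exists_iterate_add_eq_pow_smul {K R V : Type*} [CommRing K] [CommRing R] [AddCommGroup V]
    [Algebra K R] [Module K V] [Module R V] [IsScalarTower K R V] (F : Module.End K V) (L : R)
    (c : K) (hF : ∀ x, ∃ y, F x = x + L • y) (hL : ∀ x, F (L • x) = c • L • F x) (v : V) (t : ℕ) :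
    ∃ u ∈ Submodule.span K ((fun s => (F ^ s) v) '' Set.Iio t), ∃ w : V,
      (F ^ t) v + u = L ^ t • w := by
  have hLpow : ∀ (t : ℕ) (x : V), F (L ^ t • x) = c ^ t • L ^ t • F x := by
    intro t
    induction t with
    | zero => simp
    | succ t ih =>
      intro x
      rw [pow_succ, mul_smul, ih, hL, smul_comm (L ^ t) c, pow_succ, mul_smul, mul_smul]
  induction t with
  | zero => exact ⟨0, Submodule.zero_mem _, v, by simp⟩
  | succ t ih =>
    obtain ⟨u, hu, w, hw⟩ := ih
    obtain ⟨y, hy⟩ := hF w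
    have hmono : Submodule.span K ((fun s => (F ^ s) v) '' Set.Iio t) ≤
        Submodule.span K ((fun s => (F ^ s) v) '' Set.Iio (t + 1)) :=
      Submodule.span_mono (Set.image_mono (Set.Iio_subset_Iio t.le_succ))
    have hFu : F u ∈ Submodule.span K ((fun s => (F ^ s) v) '' Set.Iio (t + 1)) := by
      have := Submodule.mem_map_of_mem (f := F) hu
      rw [Submodule.map_span] at this
      refine Submodule.span_mono ?_ this
      rintro _ ⟨_, ⟨s, hs, rfl⟩, rfl⟩
      exact ⟨s + 1, Nat.succ_lt_succ hs, by simp [pow_succ']⟩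
    refine ⟨F u - c ^ t • ((F ^ t) v + u), sub_mem hFu (Submodule.smul_mem _ _ (add_mem
      (Submodule.subset_span ⟨t, Set.mem_Iio.2 t.lt_succ_self, rfl⟩) (hmono hu))),
      c ^ t • y, ?_⟩
    have hFt : (F ^ (t + 1)) v = F ((F ^ t) v) := by simp [pow_succ']
    rw [hFt, ← add_sub_assoc, ← map_add, hw, hLpow, hy, smul_add, smul_add, add_sub_cancel_left,
      smul_smul (L ^ t) L, ← pow_succ, smul_comm]

/-- A linear form vanishing on the zero set of a nonzero linear form is proportional to it. -/
theorem exists_eq_mul_of_dotProduct_eq_zero {K ι : Type*} [Field K] [Fintype ι] [DecidableEq ι]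
    {a b : ι → K} (ha : a ≠ 0) (h : ∀ z, a ⬝ᵥ z = 0 → b ⬝ᵥ z = 0) : ∃ c : K, ∀ i, b i = c * a i := by
  obtain ⟨i, hi⟩ := Function.ne_iff.1 ha
  refine ⟨b i / a i, fun k => ?_⟩
  have := h (Pi.single k (a i) - Pi.single i (a k)) (by
    rw [dotProduct_sub, dotProduct_single, dotProduct_single]; ring)
  rw [dotProduct_sub, dotProduct_single, dotProduct_single] at this
  have hi' : a i ≠ 0 := hi
  field_simp
  linear_combination this

theorem exists_eq_sum_C_mul_X {K ι : Type*} [CommSemiring K] [Fintype ι] {p : MvPolynomial ι K}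
    (hp : p.IsHomogeneous 1) : ∃ a : ι → K, p = ∑ i, C (a i) * X i := by
  have hp' : p ∈ homogeneousSubmodule ι K 1 := hp
  rw [homogeneousSubmodule_one_eq_span_X, Submodule.mem_span_range_iff_exists_fun] at hp'
  obtain ⟨a, ha⟩ := hp'
  exact ⟨a, by rw [← ha]; simp [smul_eq_C_mul]⟩

/-- The action `polyAct σ` as an algebra homomorphism. -/
def polyActHom {n : ℕ} (σ : GL (Fin n) ℂ) :
    MvPolynomial (Fin n) ℂ →ₐ[ℂ] MvPolynomial (Fin n) ℂ :=
  MvPolynomial.aeval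
    (fun i => ∑ j, C (((σ⁻¹ : GL (Fin n) ℂ) : Matrix (Fin n) (Fin n) ℂ) i j) * X j)

theorem polyActHom_apply {n : ℕ} (σ : GL (Fin n) ℂ) (p : MvPolynomial (Fin n) ℂ) :
    polyActHom σ p = polyAct σ p := rfl

theorem eval_polyAct {n : ℕ} (σ : GL (Fin n) ℂ) (p : MvPolynomial (Fin n) ℂ) (z : Fin n → ℂ) :
    eval z (polyAct σ p) = eval (gAct σ⁻¹ z) p := by
  induction p using MvPolynomial.induction_on with
  | C a => simp [polyAct]
  | add p q hp hq => simpa [polyAct] using congrArg₂ (· + ·) hp hq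
  | mul_X p i hp =>
    rw [← polyActHom_apply] at hp ⊢
    rw [map_mul, map_mul, map_mul, hp]
    simp [polyActHom, gAct, Matrix.mulVec, dotProduct]

theorem polyAct_pow_succ {n : ℕ} (σ : GL (Fin n) ℂ) (t : ℕ) (p : MvPolynomial (Fin n) ℂ) :
    polyAct (σ ^ (t + 1)) p = polyAct σ (polyAct (σ ^ t) p) := by
  refine MvPolynomial.funext fun z => ?_
  simp only [eval_polyAct, pow_succ', mul_inv_rev, gAct, Units.val_mul, Matrix.mulVec_mulVec]

theorem polyAct_one {n : ℕ} (p : MvPolynomial (Fin n) ℂ) : polyAct 1 p = p := by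
  refine MvPolynomial.funext fun z => ?_
  simp [eval_polyAct, gAct]

/-- If `σ` fixes the zero set of a nonzero linear form `L` pointwise, then each `σ · zᵢ - zᵢ` is a
constant multiple of `L`. -/
theorem exists_polyAct_X_eq {n : ℕ} {σ : GL (Fin n) ℂ} {L : MvPolynomial (Fin n) ℂ} (hL0 : L ≠ 0)
    (hLhom : L.IsHomogeneous 1) (hfix : ∀ z, eval z L = 0 → gAct σ z = z) :
    ∃ μ : Fin n → ℂ, ∀ i, polyAct σ (X i) = X i + C (μ i) * L := by
  obtain ⟨a, rfl⟩ := exists_eq_sum_C_mul_X hLhom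
  have ha : a ≠ 0 := by
    rintro rfl
    simp at hL0
  have hfix' : ∀ z, a ⬝ᵥ z = 0 → gAct σ⁻¹ z = z := fun z hz => by
    have hσ : gAct σ z = z := hfix z (by simpa [dotProduct] using hz)
    calc gAct σ⁻¹ z = gAct σ⁻¹ (gAct σ z) := by rw [hσ]
      _ = z := by simp only [gAct, Matrix.mulVec_mulVec, ← Units.val_mul]; simp
  have hprop : ∀ i, ∃ c : ℂ, ∀ k,
      ((σ⁻¹ : GL (Fin n) ℂ) : Matrix (Fin n) (Fin n) ℂ) i k - (Pi.single i 1 : Fin n → ℂ) k = c * a k := by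
    refine fun i => exists_eq_mul_of_dotProduct_eq_zero
      (b := ((σ⁻¹ : GL (Fin n) ℂ) : Matrix (Fin n) (Fin n) ℂ) i - Pi.single i 1) ha fun z hz => ?_
    rw [sub_dotProduct, single_one_dotProduct, sub_eq_zero]
    exact congrFun (hfix' z hz) i
  choose μ hμ using hprop
  refine ⟨μ, fun i => MvPolynomial.funext fun z => ?_⟩
  have hrow : ((σ⁻¹ : GL (Fin n) ℂ) : Matrix (Fin n) (Fin n) ℂ) i = Pi.single i 1 + μ i • a := by
    ext k
    simp [← hμ i k]
  have : eval z (polyAct σ (X i)) = (Pi.single i 1 + μ i • a) ⬝ᵥ z := by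
    rw [eval_polyAct, eval_X, ← hrow]
    rfl
  rw [this, add_dotProduct, single_one_dotProduct, smul_dotProduct]
  simp [dotProduct]

theorem dvd_polyAct_sub {n : ℕ} {σ : GL (Fin n) ℂ} {L : MvPolynomial (Fin n) ℂ}
    (h : ∀ i, L ∣ polyAct σ (X i) - X i) (p : MvPolynomial (Fin n) ℂ) : L ∣ polyAct σ p - p := by
  have hcomp : (Ideal.Quotient.mkₐ ℂ (Ideal.span {L})).comp (polyActHom σ) =
      Ideal.Quotient.mkₐ ℂ (Ideal.span {L}) :=
    MvPolynomial.algHom_ext fun i =>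
      Ideal.Quotient.eq.2 (Ideal.mem_span_singleton.2 (h i))
  exact Ideal.mem_span_singleton.1 (Ideal.Quotient.eq.1 (DFunLike.congr_fun hcomp p))

/-- If `σ` acts on the variables by adding constant multiples of the linear form `L`, then `L` is
an eigenvector of `σ`. -/
theorem exists_polyAct_eq_smul {n : ℕ} {σ : GL (Fin n) ℂ} {L : MvPolynomial (Fin n) ℂ}
    (hLhom : L.IsHomogeneous 1) {μ : Fin n → ℂ}
    (hμ : ∀ i, polyAct σ (X i) = X i + C (μ i) * L) : ∃ c : ℂ, polyAct σ L = c • L := by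
  obtain ⟨a, ha⟩ := exists_eq_sum_C_mul_X hLhom
  refine ⟨1 + ∑ i, a i * μ i, ?_⟩
  calc polyAct σ L = ∑ i, C (a i) * polyAct σ (X i) := by
        simp only [← polyActHom_apply]
        conv_lhs => rw [ha]
        simp [algHom_C, MvPolynomial.algebraMap_eq]
    _ = ∑ i, C (a i) * X i + (∑ i, C (a i) * C (μ i)) * L := by
        simp only [hμ, mul_add, Finset.sum_add_distrib, Finset.sum_mul, mul_assoc]
    _ = _ := by
        rw [← ha, smul_eq_C_mul]
        simp [add_mul]

/-- If `ρ` is a pseudoreflection with reflecting hyperplane `H = {L = 0}` and `j+1` distinct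
rows of a square polynomial matrix `N` are `v, ρ·v, …, ρʲ·v`, then `L^{j(j+1)/2}` divides
`det N`. -/
theorem pow_linear_divides_det {n q j : ℕ} (ρ : GL (Fin n) ℂ) (hρ : IsPseudoreflection ρ)
    (L : MvPolynomial (Fin n) ℂ) (hL0 : L ≠ 0) (hLhom : L.IsHomogeneous 1)
    (hLker : {z : Fin n → ℂ | MvPolynomial.eval z L = 0} = {z : Fin n → ℂ | gAct ρ z = z})
    (N : Matrix (Fin q) (Fin q) (MvPolynomial (Fin n) ℂ))
    (v : Fin q → MvPolynomial (Fin n) ℂ)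
    (idx : Fin (j + 1) → Fin q) (hinj : Function.Injective idx)
    (hrows : ∀ t : Fin (j + 1), ∀ c : Fin q, N (idx t) c = polyAct (ρ ^ (t : ℕ)) (v c)) :
    L ^ (j * (j + 1) / 2) ∣ N.det := by
  have hfix : ∀ z, eval z L = 0 → gAct ρ z = z := fun z hz => (Set.ext_iff.1 hLker z).1 hz
  obtain ⟨μ, hμ⟩ := exists_polyAct_X_eq hL0 hLhom hfix
  obtain ⟨c, hc⟩ := exists_polyAct_eq_smul hLhom hμ
  have hdvd := dvd_polyAct_sub (σ := ρ) (L := L) fun i => ⟨C (μ i), by rw [hμ]; ring⟩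
  let F : Module.End ℂ (Fin q → MvPolynomial (Fin n) ℂ) :=
    (polyActHom ρ).toLinearMap.compLeft (Fin q)
  have hFapply : ∀ x k, F x k = polyAct ρ (x k) := fun _ _ => rfl
  have hFpow : ∀ (t : ℕ) k, (F ^ t) v k = polyAct (ρ ^ t) (v k) := by
    intro t
    induction t with
    | zero => simp [polyAct_one]
    | succ t ih =>
      intro k
      rw [pow_succ' F, Module.End.mul_apply, hFapply, ih, polyAct_pow_succ]
  have hF : ∀ x, ∃ y, F x = x + L • y := by
    intro x
    choose y hy using fun k => hdvd (x k)
    exact ⟨y, _root_.funext fun k => eq_add_of_sub_eq' (hy k)⟩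
  have hFL : ∀ x, F (L • x) = c • L • F x := by
    refine fun x => _root_.funext fun k => ?_
    rw [hFapply, Pi.smul_apply, smul_eq_mul, ← polyActHom_apply, map_mul, polyActHom_apply, hc,
      smul_mul_assoc]
    rfl
  have hrow : ∀ t < j + 1, N (idx (Fin.ofNat (j + 1) t)) = (F ^ t) v := fun t ht =>
    _root_.funext fun k => by rw [hrows, hFpow, Fin.val_ofNat, Nat.mod_eq_of_lt ht]
  have key := pow_sum_dvd_det L (fun t => idx (Fin.ofNat (j + 1) t)) (j + 1) ?_ N ?_
  · rwa [Finset.sum_range_id, Nat.add_sub_cancel, mul_comm] at key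
  · intro s hs t ht hst
    simpa [Fin.ext_iff, Nat.mod_eq_of_lt hs, Nat.mod_eq_of_lt ht] using hinj hst
  · intro t ht
    obtain ⟨u, hu, w, hw⟩ := exists_iterate_add_eq_pow_smul F L c hF hFL v t
    refine ⟨u, ?_, w, by rw [hrow t ht, hw]⟩
    have hu' := Submodule.span_le_restrictScalars ℂ (MvPolynomial (Fin n) ℂ) _ hu
    have himage : (fun s => N (idx (Fin.ofNat (j + 1) s))) '' Set.Iio t =
        (fun s => (F ^ s) v) '' Set.Iio t :=
      Set.image_congr fun s (hs : s < t) => hrow s (hs.trans ht)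
    exact himage ▸ hu'
end
end
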